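/- Let p be an odd prime, G a powerful p-group, and N a normal subgroup of G with N ≤ G^p and N of exponent exactly p^2. Then N contains an element of order p^2 that is central in N. -/

import Mathlib

/-- For a subgroup `H` of `G`, the subgroup generated by `n`-th powers of elements of `H`. -/
def sgPow {G : Type*} [Group G] (H : Subgroup G) (n : ℕ) : Subgroup G :=
  Subgroup.closure {x | ∃ h ∈ H, h ^ n = x}

section

open Subgroup
open scoped commutatorElement

theorem mul_pow_eq_of_commute_commutator {G : Type*} [Group G] {c d : G}
    (hc : Commute ⁅d, c⁆ c) (hd : Commute ⁅d, c⁆ d) (n : ℕ) :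
    (d * c) ^ n = c ^ n * d ^ n * ⁅d, c⁆ ^ (n * (n + 1) / 2) := by
  set z := ⁅d, c⁆ with hz
  have hdc : d * c = c * d * z := by
    have h : d * c = z * (c * d) := by simp [hz, commutatorElement_def, mul_assoc]
    rw [h, (hc.mul_right hd).eq]
  have hdcn : ∀ n : ℕ, d * c ^ n = c ^ n * d * z ^ n := by
    intro n
    induction n with
    | zero => simp
    | succ n ih =>
      calc d * c ^ (n + 1) = d * c ^ n * c := by rw [pow_succ, mul_assoc]
        _ = c ^ n * d * (z ^ n * c) := by rw [ih, mul_assoc]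
        _ = c ^ n * (d * c) * z ^ n := by rw [(hc.pow_left n).eq]; simp only [mul_assoc]
        _ = c ^ n * (c * d * z) * z ^ n := by rw [hdc]
        _ = c ^ (n + 1) * d * z ^ (n + 1) := by
          rw [pow_succ c, pow_succ' z]; simp only [mul_assoc]
  induction n with
  | zero => simp
  | succ n ih =>
    have hT : (n + 1) * (n + 1 + 1) / 2 = (n + 1) + n * (n + 1) / 2 := by
      rw [show (n + 1) * (n + 1 + 1) = n * (n + 1) + (n + 1) * 2 by ring,
        Nat.add_mul_div_right _ _ (by norm_num), add_comm]
    have hcz : Commute (z ^ (n + 1)) (d ^ n) := (hd.pow_pow _ _)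
    calc (d * c) ^ (n + 1) = (c * d * z) * (c ^ n * d ^ n * z ^ (n * (n + 1) / 2)) := by
          rw [pow_succ', ih, hdc]
      _ = c * d * (z * c ^ n) * d ^ n * z ^ (n * (n + 1) / 2) := by simp only [mul_assoc]
      _ = c * (d * c ^ n) * z * d ^ n * z ^ (n * (n + 1) / 2) := by
          rw [(hc.pow_right n).eq]; simp only [mul_assoc]
      _ = c * c ^ n * d * (z ^ (n + 1) * d ^ n) * z ^ (n * (n + 1) / 2) := by
          rw [hdcn, pow_succ z]; simp only [mul_assoc]
      _ = c ^ (n + 1) * d ^ (n + 1) * z ^ ((n + 1) * (n + 1 + 1) / 2) := by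
          rw [hcz.eq, hT, pow_add z (n + 1), pow_succ' c, pow_succ' d]; simp only [mul_assoc]

theorem mul_pow_odd_of_commute_commutator {G : Type*} [Group G] {p : ℕ} (hodd : Odd p) {c d : G}
    (hc : Commute ⁅d, c⁆ c) (hd : Commute ⁅d, c⁆ d) (hz : ⁅d, c⁆ ^ p = 1) :
    (d * c) ^ p = c ^ p * d ^ p := by
  obtain ⟨k, hk⟩ := hodd
  have : p * (p + 1) / 2 = p * (k + 1) := by
    rw [show p * (p + 1) = p * (k + 1) * 2 by rw [hk]; ring, Nat.mul_div_cancel _ (by norm_num)]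
  rw [mul_pow_eq_of_commute_commutator hc hd, this, pow_mul, hz, one_pow, mul_one]

theorem commutator_pow_eq_one {G : Type*} [Group G] {p : ℕ} {c d : G}
    (hd : Commute ⁅d, c⁆ d) (hdp : d ^ p = 1) : ⁅d, c⁆ ^ p = 1 := by
  have h : c * d * c⁻¹ = ⁅d, c⁆⁻¹ * d := by simp [commutatorElement_def, mul_assoc]
  have h2 : (c * d * c⁻¹) ^ p = 1 := by rw [conj_pow, hdp]; simp
  rw [h, hd.inv_left.mul_pow, hdp, mul_one, inv_pow, inv_eq_one] at h2
  exact h2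

theorem commute_pow_of_commutator_pow_eq_one {G : Type*} [Group G] {p : ℕ} (hodd : Odd p)
    {n r : G} (hd : ⁅n, r⁆ ^ p = 1) (hr : Commute ⁅⁅n, r⁆, r⁆ r)
    (hdr : Commute ⁅⁅n, r⁆, r⁆ ⁅n, r⁆) : Commute n (r ^ p) := by
  have h1 : (⁅n, r⁆ * r) ^ p = r ^ p := by
    rw [mul_pow_odd_of_commute_commutator hodd hr hdr (commutator_pow_eq_one hdr hd), hd,
      mul_one]
  have h2 : ⁅n, r⁆ * r = n * r * n⁻¹ := by simp [commutatorElement_def]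
  rw [h2, conj_pow, mul_inv_eq_iff_eq_mul] at h1
  exact h1

theorem sgPow_mono {G : Type*} [Group G] {H K : Subgroup G} (h : H ≤ K) (n : ℕ) :
    sgPow H n ≤ sgPow K n := by
  apply Subgroup.closure_mono
  rintro x ⟨y, hy, rfl⟩
  exact ⟨y, h hy, rfl⟩

theorem sgPow_le {G : Type*} [Group G] (H : Subgroup G) (n : ℕ) : sgPow H n ≤ H := by
  rw [sgPow, closure_le]
  rintro x ⟨y, hy, rfl⟩
  exact H.pow_mem hy n

theorem pow_mem_sgPow {G : Type*} [Group G] {H : Subgroup G} {x : G} (hx : x ∈ H) (n : ℕ) :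
    x ^ n ∈ sgPow H n :=
  subset_closure ⟨x, hx, rfl⟩

theorem map_sgPow {G K : Type*} [Group G] [Group K] (f : G →* K) (H : Subgroup G) (n : ℕ) :
    (sgPow H n).map f = sgPow (H.map f) n := by
  rw [sgPow, sgPow, MonoidHom.map_closure]
  congr 1
  ext x
  constructor
  · rintro ⟨_, ⟨y, hy, rfl⟩, rfl⟩
    exact ⟨f y, mem_map_of_mem f hy, (map_pow f y n).symm⟩
  · rintro ⟨_, ⟨y, hy, rfl⟩, rfl⟩
    exact ⟨y ^ n, ⟨y, hy, rfl⟩, map_pow f y n⟩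

instance sgPow_normal {G : Type*} [Group G] (H : Subgroup G) [hH : H.Normal] (n : ℕ) :
    (sgPow H n).Normal := by
  refine ⟨fun x hx g => ?_⟩
  have h1 := map_sgPow (MulAut.conj g).toMonoidHom H n
  have h2 : H.map (MulAut.conj g).toMonoidHom ≤ H := by
    rintro _ ⟨y, hy, rfl⟩
    exact hH.conj_mem y hy g
  exact sgPow_mono h2 n (h1 ▸ mem_map_of_mem _ hx)

theorem le_of_le_sup_commutator {G : Type*} [Group G] [hG : Group.IsNilpotent G]
    (X K : Subgroup G) [X.Normal] [K.Normal] (h : X ≤ K ⊔ ⁅X, (⊤ : Subgroup G)⁆) : X ≤ K := by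
  have h1 : X.map (QuotientGroup.mk' K) ≤
      ⁅X.map (QuotientGroup.mk' K), (⊤ : Subgroup (G ⧸ K))⁆ := by
    rw [← map_top_of_surjective _ (QuotientGroup.mk'_surjective K), ← map_commutator]
    refine (map_mono h).trans ?_
    rw [Subgroup.map_sup]
    refine sup_le ?_ le_rfl
    rw [(Subgroup.map_eq_bot_iff _).2 (by simp)]
    exact bot_le
  obtain ⟨n, hn⟩ := Subgroup.nilpotent_iff_lowerCentralSeries.1
    (inferInstance : Group.IsNilpotent (G ⧸ K))
  have h2 : ∀ n, X.map (QuotientGroup.mk' K) ≤ (⊤ : Subgroup (G ⧸ K)).lowerCentralSeries n := by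
    intro n
    induction n with
    | zero => simp
    | succ n ih => exact h1.trans (commutator_mono ih le_rfl)
  have h3 := h2 n
  rw [hn, le_bot_iff, Subgroup.map_eq_bot_iff] at h3
  simpa using h3

/-- If `B` is generated by `p`-th powers of elements of `A`, commutators of `A` with `H` lie in `B`
and `p`-th powers of elements of `B` lie in `K`, then `⁅B, H⁆ ≤ K`. -/
theorem commutator_le_of_pow_mem {G : Type*} [Group G] [Group.IsNilpotent G] {p : ℕ}
    (hodd : Odd p) (A : Set G) (H B K : Subgroup G) [H.Normal] [B.Normal] [K.Normal]
    (hAH : A ⊆ H) (hB : B ≤ closure {x | ∃ c ∈ A, c ^ p = x})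
    (hAB : ∀ c ∈ A, ∀ r ∈ H, ⁅c, r⁆ ∈ B) (hBK : ∀ b ∈ B, b ^ p ∈ K) : ⁅B, H⁆ ≤ K := by
  apply le_of_le_sup_commutator
  set L := K ⊔ ⁅⁅B, H⁆, (⊤ : Subgroup G)⁆ with hL
  have key : ∀ x : G, x ∈ L ↔ QuotientGroup.mk' L x = 1 := fun x => by simp
  have hcomm : ∀ a b : G, Commute (QuotientGroup.mk' L a) (QuotientGroup.mk' L b) ↔ ⁅a, b⁆ ∈ L := by
    intro a b
    rw [key, map_commutatorElement, commutatorElement_eq_one_iff_commute]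
  have hcent : ∀ e ∈ ⁅B, H⁆, ∀ g : G,
      Commute (QuotientGroup.mk' L e) (QuotientGroup.mk' L g) := by
    intro e he g
    rw [hcomm]
    exact (le_sup_right : _ ≤ L) (commutator_mem_commutator he (mem_top g))
  rw [commutator_le]
  intro b hb r hr
  rw [← hcomm]
  replace hb := hB hb
  induction hb using closure_induction with
  | mem x hx =>
    obtain ⟨c, hc, rfl⟩ := hx
    have hrc : ⁅r, c⁆ ∈ B := by rw [← commutatorElement_inv]; exact B.inv_mem (hAB c hc r hr)
    have he : ⁅⁅r, c⁆, c⁆ ∈ ⁅B, H⁆ := commutator_mem_commutator hrc (hAH hc)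
    rw [map_pow]
    symm
    apply commute_pow_of_commutator_pow_eq_one hodd
    · rw [← map_commutatorElement, ← map_pow, ← key]
      exact (le_sup_left : K ≤ L) (hBK _ hrc)
    · simpa only [map_commutatorElement] using hcent _ he c
    · simpa only [map_commutatorElement] using hcent _ he ⁅r, c⁆
  | one => rw [map_one]; exact Commute.one_left _
  | mul x y _ _ hx hy => rw [map_mul]; exact hx.mul_left hy
  | inv x _ hx => rw [map_inv]; exact hx.inv_left

/-- A group is powerful at an odd prime `p` if its commutators are products of `p`-th powers. -/
def PowerfulGroup (p : ℕ) (G : Type*) [Group G] : Prop :=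
  ⁅(⊤ : Subgroup G), (⊤ : Subgroup G)⁆ ≤ sgPow ⊤ p

theorem map_subtype_sgPow_top {G : Type*} [Group G] (H : Subgroup G) (p : ℕ) :
    (sgPow (⊤ : Subgroup H) p).map H.subtype = sgPow H p := by
  rw [map_sgPow, ← MonoidHom.range_eq_map, range_subtype]

theorem map_sgPow_top {G K : Type*} [Group G] [Group K] {f : G →* K}
    (hf : Function.Surjective f) (p : ℕ) : (sgPow ⊤ p).map f = sgPow ⊤ p := by
  rw [map_sgPow, map_top_of_surjective f hf]

theorem powerfulGroup_subgroup {G : Type*} [Group G] {p : ℕ} {H : Subgroup G}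
    (h : ⁅H, H⁆ ≤ sgPow H p) : PowerfulGroup p H := by
  rw [PowerfulGroup, ← map_subtype_le_map_subtype, map_commutator, map_subtype_sgPow_top,
    ← MonoidHom.range_eq_map, range_subtype]
  exact h

namespace PowerfulGroup

variable {G : Type*} [Group G] {p : ℕ}

theorem of_surjective {K : Type*} [Group K] (hG : PowerfulGroup p G) {f : G →* K}
    (hf : Function.Surjective f) : PowerfulGroup p K := by
  rw [PowerfulGroup, ← map_top_of_surjective f hf, ← map_commutator, ← map_sgPow]
  exact map_mono hG

theorem zpowers_sup_sgPow_normal (hG : PowerfulGroup p G) (x : G) :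
    (zpowers x ⊔ sgPow (⊤ : Subgroup G) p).Normal :=
  Normal.of_commutator_le _ (hG.trans le_sup_right)

variable [Finite G]

theorem commutator_sgPow_le (hG : PowerfulGroup p G) (hp : p.Prime) (hodd : Odd p)
    (hpG : IsPGroup p G) : ⁅sgPow (⊤ : Subgroup G) p, (⊤ : Subgroup G)⁆ ≤ sgPow (sgPow ⊤ p) p := by
  have := Fact.mk hp
  have := hpG.isNilpotent
  exact commutator_le_of_pow_mem hodd Set.univ ⊤ (sgPow ⊤ p) (sgPow (sgPow ⊤ p) p) (by simp)
    (closure_mono (by rintro x ⟨h, -, rfl⟩; exact ⟨h, trivial, rfl⟩))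
    (fun c _ r _ => hG (commutator_mem_commutator (mem_top c) (mem_top r)))
    (fun b hb => pow_mem_sgPow hb p)

theorem sgPow_powerful (hG : PowerfulGroup p G) (hp : p.Prime) (hodd : Odd p)
    (hpG : IsPGroup p G) : PowerfulGroup p (sgPow (⊤ : Subgroup G) p) :=
  powerfulGroup_subgroup
    ((commutator_mono le_rfl le_top).trans (hG.commutator_sgPow_le hp hodd hpG))

theorem zpowers_sup_sgPow_powerful (hG : PowerfulGroup p G) (hp : p.Prime) (hodd : Odd p)
    (hpG : IsPGroup p G) (x : G) : PowerfulGroup p ↥(zpowers x ⊔ sgPow (⊤ : Subgroup G) p) := by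
  apply powerfulGroup_subgroup
  refine le_trans ?_ (sgPow_mono (le_sup_right : sgPow ⊤ p ≤ _) p)
  set L := sgPow (sgPow (⊤ : Subgroup G) p) p
  have hcomm : ∀ a b : G, Commute (QuotientGroup.mk' L a) (QuotientGroup.mk' L b) ↔ ⁅a, b⁆ ∈ L := by
    intro a b
    rw [← QuotientGroup.eq_one_iff, ← QuotientGroup.mk'_apply, map_commutatorElement,
      commutatorElement_eq_one_iff_commute]
  have hcent : ∀ a ∈ sgPow (⊤ : Subgroup G) p, ∀ b : G,
      Commute (QuotientGroup.mk' L a) (QuotientGroup.mk' L b) := fun a ha b =>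
    (hcomm a b).2 (hG.commutator_sgPow_le hp hodd hpG (commutator_mem_commutator ha (mem_top b)))
  rw [commutator_le]
  intro g hg h hh
  obtain ⟨_, ⟨i, rfl⟩, a, ha, rfl⟩ := mem_sup_of_normal_right.1 hg
  obtain ⟨_, ⟨j, rfl⟩, b, hb, rfl⟩ := mem_sup_of_normal_right.1 hh
  rw [← hcomm, map_mul]
  refine Commute.mul_left ?_ (hcent a ha _)
  rw [map_mul]
  refine Commute.mul_right ?_ (hcent b hb _).symm
  simp only [map_zpow]
  exact (Commute.refl _).zpow_zpow i j

theorem zpowers_eq_top_of_sup_sgPow_eq_top (hp : p.Prime) (hpG : IsPGroup p G) {x : G}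
    (hx : zpowers x ⊔ sgPow (⊤ : Subgroup G) p = ⊤) : zpowers x = ⊤ := by
  have := Fact.mk hp
  have := hpG.isNilpotent
  by_contra hne
  obtain ⟨M, hM, hxM⟩ := (eq_top_or_exists_le_coatom (zpowers x)).resolve_left hne
  have hMn : M.Normal := by
    have := (Group.isNilpotent_of_finite_tfae (G := G)).out 0 2
    exact this.1 inferInstance M hM
  apply hM.1
  rw [← top_le_iff, ← hx]
  refine sup_le hxM ?_
  rw [sgPow, closure_le]
  rintro _ ⟨g, -, rfl⟩
  by_contra hg
  have hg : g ^ p ∉ M := hg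
  have htop : M ⊔ zpowers (g ^ p) = ⊤ := by
    apply hM.2
    refine lt_of_le_of_ne le_sup_left fun h => hg ?_
    rw [h]
    exact (le_sup_right : zpowers (g ^ p) ≤ _) (mem_zpowers _)
  obtain ⟨m, hm, _, ⟨k, rfl⟩, hmk⟩ := mem_sup_of_normal_left.1 (htop ▸ mem_top g)
  have hgm : g ^ (1 - p * k : ℤ) ∈ M := by
    have : g ^ (1 - p * k : ℤ) = m := by
      rw [zpow_sub, zpow_one, zpow_mul, zpow_natCast]
      exact mul_inv_eq_of_eq_mul hmk.symm
    rwa [this]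
  obtain ⟨n, hn⟩ := hpG g
  have hcop : IsCoprime (1 - p * k : ℤ) ((p : ℤ) ^ n) := IsCoprime.pow_right ⟨1, k, by ring⟩
  obtain ⟨a, b, hab⟩ := hcop
  apply hg
  apply M.pow_mem
  rw [← zpow_one g, ← hab, zpow_add, mul_comm a, mul_comm b, zpow_mul, zpow_mul]
  have h1 : g ^ ((p : ℤ) ^ n) = 1 := by exact_mod_cast hn
  rw [h1, one_zpow, mul_one]
  exact M.zpow_mem hgm a

theorem exists_pow_mul (hG : PowerfulGroup p G) (hp : p.Prime) (hodd : Odd p)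
    (hpG : IsPGroup p G) {g : G} (hg : g ∈ sgPow (⊤ : Subgroup G) p) :
    ∃ x, ∃ w ∈ sgPow (sgPow (⊤ : Subgroup G) p) p, x ^ p * w = g := by
  set L := sgPow (sgPow (⊤ : Subgroup G) p) p with hL
  suffices h : ∃ x, QuotientGroup.mk' L g = QuotientGroup.mk' L x ^ p by
    obtain ⟨x, hx⟩ := h
    rw [← map_pow, eq_comm, QuotientGroup.mk'_apply, QuotientGroup.mk'_apply,
      QuotientGroup.eq] at hx
    exact ⟨x, _, hx, by group⟩
  have hcent : ∀ a ∈ sgPow (⊤ : Subgroup G) p, ∀ b : G,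
      Commute (QuotientGroup.mk' L a) (QuotientGroup.mk' L b) := by
    intro a ha b
    rw [← commutatorElement_eq_one_iff_commute, ← map_commutatorElement, QuotientGroup.mk'_apply,
      QuotientGroup.eq_one_iff]
    exact hG.commutator_sgPow_le hp hodd hpG (commutator_mem_commutator ha (mem_top b))
  induction hg using closure_induction with
  | mem x hx =>
    obtain ⟨y, -, rfl⟩ := hx
    exact ⟨y, map_pow _ _ _⟩
  | one => exact ⟨1, by simp⟩
  | mul x y _ _ hx hy =>
    obtain ⟨x', hx'⟩ := hx
    obtain ⟨y', hy'⟩ := hy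
    have hz : ⁅y', x'⁆ ∈ sgPow (⊤ : Subgroup G) p :=
      hG (commutator_mem_commutator (mem_top _) (mem_top _))
    refine ⟨y' * x', ?_⟩
    rw [map_mul, map_mul, mul_pow_odd_of_commute_commutator hodd, hx', hy']
    · simpa only [map_commutatorElement] using hcent _ hz x'
    · simpa only [map_commutatorElement] using hcent _ hz y'
    · rw [← map_commutatorElement, ← map_pow, QuotientGroup.mk'_apply, QuotientGroup.eq_one_iff]
      exact pow_mem_sgPow hz p
  | inv x _ hx =>
    obtain ⟨x', hx'⟩ := hx
    exact ⟨x'⁻¹, by rw [map_inv, map_inv, hx', inv_pow]⟩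

/-- In a powerful `p`-group with `p` odd, a product of `p`-th powers is a `p`-th power. -/
theorem exists_pow_eq_of_mem_sgPow {p : ℕ} (hp : p.Prime) (hodd : Odd p) :
    ∀ (n : ℕ) (G : Type*) [Group G] [Finite G], Nat.card G = n → IsPGroup p G →
      PowerfulGroup p G → ∀ g ∈ sgPow (⊤ : Subgroup G) p, ∃ h, h ^ p = g := by
  intro n
  induction n using Nat.strong_induction_on with
  | _ n ih =>
  intro G _ _ hn hpG hG g hg
  obtain ⟨x, w, hw, rfl⟩ := hG.exists_pow_mul hp hodd hpG hg
  set H := zpowers x ⊔ sgPow (⊤ : Subgroup G) p with hH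
  have hxH : x ∈ H := (le_sup_left : zpowers x ≤ H) (mem_zpowers x)
  have hmem : x ^ p * w ∈ sgPow H p :=
    mul_mem (pow_mem_sgPow hxH p) (sgPow_mono (le_sup_right : sgPow ⊤ p ≤ H) p hw)
  by_cases htop : H = ⊤
  · have hz := zpowers_eq_top_of_sup_sgPow_eq_top hp hpG htop
    have hcomm : ∀ a b : G, Commute a b := by
      intro a b
      obtain ⟨i, rfl⟩ := mem_zpowers_iff.1 (hz ▸ mem_top a)
      obtain ⟨j, rfl⟩ := mem_zpowers_iff.1 (hz ▸ mem_top b)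
      exact (Commute.refl x).zpow_zpow i j
    generalize x ^ p * w = y at hg
    induction hg using closure_induction with
    | mem y hy => obtain ⟨z, -, rfl⟩ := hy; exact ⟨z, rfl⟩
    | one => exact ⟨1, one_pow p⟩
    | mul a b _ _ ha hb =>
      obtain ⟨a, rfl⟩ := ha
      obtain ⟨b, rfl⟩ := hb
      exact ⟨a * b, (hcomm a b).mul_pow p⟩
    | inv a _ ha =>
      obtain ⟨a, rfl⟩ := ha
      exact ⟨a⁻¹, inv_pow a p⟩
  · have hlt : Nat.card H < n := by
      rw [← hn]
      exact lt_of_le_of_ne (card_le_card_group H) fun h => htop (H.eq_top_of_card_eq h)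
    rw [← map_subtype_sgPow_top] at hmem
    obtain ⟨y, hy, hyx⟩ := hmem
    obtain ⟨h, rfl⟩ := ih _ hlt H rfl (hpG.to_subgroup H)
      (hG.zpowers_sup_sgPow_powerful hp hodd hpG x) y hy
    exact ⟨h, hyx⟩

end PowerfulGroup

/-- The elements of order dividing `p` are closed under multiplication, and commute with those
of them that lie in the subgroup generated by `p`-th powers. -/
structure OmegaRegular (p : ℕ) (G : Type*) [Group G] : Prop where
  mul_pow_eq_one : ∀ x y : G, x ^ p = 1 → y ^ p = 1 → (x * y) ^ p = 1
  commute : ∀ x y : G, x ∈ sgPow (⊤ : Subgroup G) p → x ^ p = 1 → y ^ p = 1 → Commute x y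

namespace PowerfulGroup

variable {G : Type*} [Group G] [Finite G] {p : ℕ}

theorem exists_pow_eq_of_mem_sgPow_sgPow (hG : PowerfulGroup p G) (hp : p.Prime) (hodd : Odd p)
    (hpG : IsPGroup p G) {g : G} (hg : g ∈ sgPow (sgPow (⊤ : Subgroup G) p) p) :
    ∃ c ∈ sgPow (⊤ : Subgroup G) p, c ^ p = g := by
  rw [← map_subtype_sgPow_top] at hg
  obtain ⟨y, hy, rfl⟩ := hg
  obtain ⟨h, rfl⟩ := exists_pow_eq_of_mem_sgPow hp hodd _ _ rfl (hpG.to_subgroup _)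
    (hG.sgPow_powerful hp hodd hpG) y hy
  exact ⟨h, h.2, rfl⟩

theorem exists_root_subgroup (hG : PowerfulGroup p G) (hp : p.Prime) (hodd : Odd p)
    (hpG : IsPGroup p G) (N : Subgroup G) [hN : N.Normal] (hQ : OmegaRegular p (G ⧸ N)) :
    ∃ R : Subgroup G, R.Normal ∧ (∀ r, r ∈ R ↔ r ^ p ∈ N) ∧
      ⁅N ⊓ sgPow (sgPow ⊤ p) p, R⁆ ≤ sgPow (N ⊓ sgPow (sgPow ⊤ p) p) p := by
  have := Fact.mk hp
  have := hpG.isNilpotent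
  have key : ∀ r : G, r ^ p ∈ N ↔ QuotientGroup.mk' N r ^ p = 1 := fun r => by
    rw [← map_pow, QuotientGroup.mk'_apply, QuotientGroup.eq_one_iff]
  let R : Subgroup G :=
    { carrier := {r | r ^ p ∈ N}
      mul_mem' := fun {a b} ha hb => by
        change a ^ p ∈ N at ha
        change b ^ p ∈ N at hb
        change (a * b) ^ p ∈ N
        rw [key] at *
        rw [map_mul]
        exact hQ.mul_pow_eq_one _ _ ha hb
      one_mem' := by simp
      inv_mem' := fun {a} ha => by
        change a⁻¹ ^ p ∈ N
        rw [inv_pow]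
        exact N.inv_mem ha }
  have hR : ∀ r, r ∈ R ↔ r ^ p ∈ N := fun r => Iff.rfl
  have hRn : R.Normal := ⟨fun r hr g => by
    rw [hR, conj_pow]
    exact hN.conj_mem _ hr g⟩
  refine ⟨R, hRn, hR, ?_⟩
  refine commutator_le_of_pow_mem hodd (R ⊓ sgPow ⊤ p : Subgroup G) R _ _
    (fun x hx => hx.1) ?_ ?_ fun b hb => pow_mem_sgPow hb p
  · rintro g ⟨hgN, hg⟩
    obtain ⟨c, hc, rfl⟩ := hG.exists_pow_eq_of_mem_sgPow_sgPow hp hodd hpG hg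
    exact subset_closure ⟨c, ⟨hgN, hc⟩, rfl⟩
  · rintro c ⟨hcR, hc⟩ r hr
    refine ⟨?_, hG.commutator_sgPow_le hp hodd hpG (commutator_mem_commutator hc (mem_top r))⟩
    change ⁅c, r⁆ ∈ N
    rw [← QuotientGroup.eq_one_iff, ← QuotientGroup.mk'_apply, map_commutatorElement,
      commutatorElement_eq_one_iff_commute]
    refine hQ.commute _ _ ?_ ((key c).1 hcR) ((key r).1 hr)
    rw [← map_sgPow_top (QuotientGroup.mk'_surjective N)]
    exact mem_map_of_mem _ hc

theorem commute_pow_of_forall_pow_eq_one (hG : PowerfulGroup p G) (hp : p.Prime) (hodd : Odd p)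
    (hpG : IsPGroup p G) (N : Subgroup G) [N.Normal] (hQ : OmegaRegular p (G ⧸ N))
    (hb : ∀ b ∈ N ⊓ sgPow (sgPow (⊤ : Subgroup G) p) p, b ^ p = 1) {n r : G} (hn : n ∈ N)
    (hr : r ^ p ∈ N) (hnr : ⁅n, r⁆ ^ p = 1) : Commute n (r ^ p) := by
  obtain ⟨R, hRn, hR, hle⟩ := hG.exists_root_subgroup hp hodd hpG N hQ
  have hbot : sgPow (N ⊓ sgPow (sgPow (⊤ : Subgroup G) p) p) p ≤ ⊥ := by
    rw [sgPow, closure_le]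
    rintro _ ⟨b, h, rfl⟩
    exact hb b h
  have hnrN : ∀ {n}, n ∈ N → ⁅n, r⁆ ∈ N := fun {n} hn =>
    commutator_le_left N ⊤ (commutator_mem_commutator hn (mem_top r))
  have hmem : ⁅⁅n, r⁆, r⁆ ∈ N ⊓ sgPow (sgPow (⊤ : Subgroup G) p) p :=
    ⟨hnrN (hnrN hn), hG.commutator_sgPow_le hp hodd hpG (commutator_mem_commutator
      (hG (commutator_mem_commutator (mem_top n) (mem_top r))) (mem_top r))⟩
  have hc : ∀ s ∈ R, Commute ⁅⁅n, r⁆, r⁆ s := fun s hs =>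
    commutatorElement_eq_one_iff_commute.1
      (mem_bot.1 (hbot (hle (commutator_mem_commutator hmem hs))))
  exact commute_pow_of_commutator_pow_eq_one hodd hnr (hc r ((hR r).2 hr))
    (hc _ ((hR _).2 (N.pow_mem (hnrN hn) p)))

end PowerfulGroup

theorem omegaRegular_of_powerfulGroup {p : ℕ} (hp : p.Prime) (hodd : Odd p) :
    ∀ (n : ℕ) (G : Type*) [Group G] [Finite G], Nat.card G = n → IsPGroup p G →
      PowerfulGroup p G → OmegaRegular p G := by
  intro n
  induction n using Nat.strong_induction_on with
  | _ n ih =>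
  intro G _ _ hn hpG hG
  by_cases hab : ∀ a b : G, Commute a b
  · exact ⟨fun x y hx hy => by rw [(hab x y).mul_pow, hx, hy, one_mul], fun x y _ _ _ => hab x y⟩
  have claim : ∀ x : G, x ^ p = 1 → ∃ N : Subgroup G, N.Normal ∧ x ∈ N ∧ (∀ y ∈ N, y ^ p = 1) ∧
      ∀ e ∈ sgPow (⊤ : Subgroup G) p, e ^ p = 1 → Commute x e := by
    intro x hx
    by_cases hx1 : x = 1
    · subst hx1
      exact ⟨⊥, inferInstance, one_mem _, fun y hy => by rw [mem_bot.1 hy, one_pow],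
        fun e _ _ => Commute.one_left e⟩
    set H := zpowers x ⊔ sgPow (⊤ : Subgroup G) p with hH
    have hHn : H.Normal := hG.zpowers_sup_sgPow_normal x
    have hxH : x ∈ H := (le_sup_left : zpowers x ≤ H) (mem_zpowers x)
    have hlt : Nat.card H < n := by
      rw [← hn]
      refine lt_of_le_of_ne (card_le_card_group H) fun h => hab fun a b => ?_
      have hz := PowerfulGroup.zpowers_eq_top_of_sup_sgPow_eq_top hp hpG (H.eq_top_of_card_eq h)
      obtain ⟨i, rfl⟩ := mem_zpowers_iff.1 (hz ▸ mem_top a)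
      obtain ⟨j, rfl⟩ := mem_zpowers_iff.1 (hz ▸ mem_top b)
      exact (Commute.refl x).zpow_zpow i j
    have hQH := ih _ hlt H rfl (hpG.to_subgroup H)
      (hG.zpowers_sup_sgPow_powerful hp hodd hpG x)
    let N : Subgroup G :=
      { carrier := {y | y ∈ H ∧ y ^ p = 1}
        mul_mem' := fun {a b} ha hb => ⟨H.mul_mem ha.1 hb.1, congrArg Subtype.val
          (hQH.mul_pow_eq_one ⟨a, ha.1⟩ ⟨b, hb.1⟩ (Subtype.ext ha.2) (Subtype.ext hb.2))⟩
        one_mem' := ⟨H.one_mem, one_pow p⟩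
        inv_mem' := fun {a} ha => ⟨H.inv_mem ha.1, by rw [inv_pow, ha.2, inv_one]⟩ }
    have hNn : N.Normal := ⟨fun y hy g => ⟨hHn.conj_mem y hy.1 g, by
      rw [conj_pow, hy.2, mul_one, mul_inv_cancel]⟩⟩
    have hxN : x ∈ N := ⟨hxH, hx⟩
    have hltN : Nat.card (G ⧸ N) < n := by
      rw [← hn, N.card_eq_card_quotient_mul_card_subgroup]
      refine lt_mul_of_one_lt_right Nat.card_pos ?_
      rw [one_lt_card_iff_ne_bot]
      rintro h
      exact hx1 (mem_bot.1 (h ▸ hxN))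
    have hQN := ih _ hltN (G ⧸ N) rfl (hpG.to_quotient N)
      (hG.of_surjective (QuotientGroup.mk'_surjective N))
    refine ⟨N, hNn, hxN, fun y hy => hy.2, fun e he hep => ?_⟩
    obtain ⟨r, rfl⟩ := PowerfulGroup.exists_pow_eq_of_mem_sgPow hp hodd _ G rfl hpG hG e he
    exact hG.commute_pow_of_forall_pow_eq_one hp hodd hpG N hQN (fun b hb => hb.1.2) hxN
      ⟨(le_sup_right : _ ≤ H) he, hep⟩
      (commutator_le_left N ⊤ (commutator_mem_commutator hxN (mem_top r))).2
  refine ⟨fun x y hx hy => ?_, fun x y hxP hx hy => ?_⟩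
  · obtain ⟨N, hN, hxN, hNp, hxc⟩ := claim x hx
    obtain ⟨-, -, -, -, hyc⟩ := claim y hy
    have hP := hG (commutator_mem_commutator (mem_top x) (mem_top y))
    have hz := hNp _ (commutator_le_left N ⊤ (commutator_mem_commutator hxN (mem_top y)))
    rw [mul_pow_odd_of_commute_commutator hodd (hyc _ hP hz).symm (hxc _ hP hz).symm hz, hx, hy,
      one_mul]
  · obtain ⟨-, -, -, -, hyc⟩ := claim y hy
    exact (hyc x hxP hx).symm

namespace PowerfulGroup

theorem exists_orderOf_eq_forall_commute {G : Type*} [Group G] [Finite G] {p : ℕ}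
    (hG : PowerfulGroup p G) (hp : p.Prime) (hodd : Odd p) (hpG : IsPGroup p G)
    {N : Subgroup G} (hN : N.Normal) (hNle : N ≤ sgPow ⊤ p)
    (hexp : Monoid.exponent N = p ^ 2) :
    ∃ x ∈ N, orderOf x = p ^ 2 ∧ ∀ y ∈ N, Commute x y := by
  have := Fact.mk hp
  have := hpG.isNilpotent
  have hQ := omegaRegular_of_powerfulGroup hp hodd _ G rfl hpG hG
  have hQN := omegaRegular_of_powerfulGroup hp hodd _ (G ⧸ N) rfl (hpG.to_quotient N)
    (hG.of_surjective (QuotientGroup.mk'_surjective N))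
  have hpp : ∀ x ∈ N, x ^ p ^ 2 = 1 := fun x hx =>
    congrArg Subtype.val (hexp ▸ Monoid.pow_exponent_eq_one (⟨x, hx⟩ : N))
  have hord : ∀ x ∈ N, x ^ p ≠ 1 → orderOf x = p ^ 2 := fun x hx hxp =>
    orderOf_eq_prime_pow (by rwa [pow_one]) (hpp x hx)
  have hroot : ∀ y ∈ N, ∃ r, r ^ p = y := fun y hy =>
    exists_pow_eq_of_mem_sgPow hp hodd _ G rfl hpG hG y (hNle hy)
  have hmem : ∀ n ∈ N, ∀ r, ⁅n, r⁆ ∈ N ⊓ sgPow (sgPow (⊤ : Subgroup G) p) p := fun n hn r =>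
    ⟨commutator_le_left N ⊤
      (commutator_mem_commutator hn (mem_top r)),
      hG.commutator_sgPow_le hp hodd hpG
        (commutator_mem_commutator (hNle hn) (mem_top r))⟩
  by_cases hb : ∀ b ∈ N ⊓ sgPow (sgPow (⊤ : Subgroup G) p) p, b ^ p = 1
  · obtain ⟨x, hx, hxp⟩ : ∃ x ∈ N, x ^ p ≠ 1 := by
      by_contra! h
      have h1 : p ^ 2 ∣ p ^ 1 := by
        rw [← hexp, pow_one]
        exact Monoid.exponent_dvd_of_forall_pow_eq_one fun y => Subtype.ext (h y y.2)
      have h2 := (Nat.pow_dvd_pow_iff_le_right hp.one_lt).1 h1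
      omega
    refine ⟨x, hx, hord x hx hxp, fun y hy => ?_⟩
    obtain ⟨r, rfl⟩ := hroot y hy
    exact hG.commute_pow_of_forall_pow_eq_one hp hodd hpG N hQN hb hx hy (hb _ (hmem x hx r))
  · push Not at hb
    obtain ⟨x, hx, hxp⟩ := hb
    refine ⟨x, hx.1, hord x hx.1 hxp, fun y hy => ?_⟩
    obtain ⟨r, rfl⟩ := hroot y hy
    obtain ⟨R, hRn, hR, hle⟩ := hG.exists_root_subgroup hp hodd hpG N hQN
    set B := N ⊓ sgPow (sgPow (⊤ : Subgroup G) p) p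
    have hBR : B ≤ R := fun m hm => (hR m).2 (N.pow_mem hm.1 p)
    have hF : ∀ f ∈ sgPow B p, f ^ p = 1 := by
      intro f hf
      induction hf using closure_induction with
      | mem f hf =>
        obtain ⟨m, hm, rfl⟩ := hf
        rw [← pow_mul, ← pow_two]
        exact hpp m hm.1
      | one => exact one_pow p
      | mul a b _ _ ha hb => exact hQ.mul_pow_eq_one a b ha hb
      | inv a _ ha => rw [inv_pow, ha, inv_one]
    have hbot : ⁅sgPow B p, R⁆ ≤ ⊥ := by
      refine commutator_le_of_pow_mem hodd (B : Set G) R (sgPow B p) ⊥ hBR ?_ ?_ ?_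
      · exact closure_mono (by rintro _ ⟨h, hh, rfl⟩; exact ⟨h, hh, rfl⟩)
      · exact fun c hc s hs => hle (commutator_mem_commutator hc hs)
      · exact fun f hf => mem_bot.2 (hF f hf)
    have hxr : ⁅x, r⁆ ∈ sgPow B p := hle (commutator_mem_commutator hx ((hR r).2 hy))
    have hc : ∀ f ∈ sgPow B p, ∀ s ∈ R, Commute f s := fun f hf s hs =>
      commutatorElement_eq_one_iff_commute.1
        (mem_bot.1 (hbot (commutator_mem_commutator hf hs)))
    have h1 : ⁅⁅x, r⁆, r⁆ = 1 := commutatorElement_eq_one_iff_commute.2 (hc _ hxr r ((hR r).2 hy))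
    refine commute_pow_of_commutator_pow_eq_one hodd (hF _ hxr) ?_ ?_ <;> rw [h1] <;>
      exact Commute.one_left _

end PowerfulGroup

end

/-- if G is a powerful p-group (p odd) and N ≤ G^p is normal in G with
exponent exactly p², then N contains an element of order p² that is central in N. -/
theorem stmt4 {G : Type*} [Group G] [Finite G] (p : ℕ) (hp : p.Prime) (hodd : Odd p)
    (hpG : IsPGroup p G)
    (hpowerful : ⁅(⊤ : Subgroup G), (⊤ : Subgroup G)⁆ ≤ sgPow ⊤ p)
    (N : Subgroup G) (hN : N.Normal) (hNle : N ≤ sgPow ⊤ p)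
    (hexp : Monoid.exponent N = p ^ 2) :
    ∃ x ∈ N, orderOf x = p ^ 2 ∧ ∀ y ∈ N, Commute x y :=
  PowerfulGroup.exists_orderOf_eq_forall_commute hpowerful hp hodd hpG hN hNle hexp
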